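/- Let τ > 0 and let F : ℝ × 𝒞 → ℝᵐ be weakly nonlinear with constants K > 0 and A ≥ 0, and assume K·τ·e < 1. Then for every (t₀, y₀) ∈ ℝ × ℝᵐ there exists a special solution ȳ : ℝ → ℝᵐ of the DDE y′(t) = F(t, y_t) with ȳ(t₀) = y₀; moreover, ȳ is the unique solution of the DDE defined on all of ℝ that satisfies both ȳ(t₀) = y₀ and the growth condition sup_{t∈ℝ} e^{−|t|/τ}·‖ȳ(t)‖∞ < ∞. -/

import Mathlib

open Set

noncomputable section

/-- The history space `𝒞 = C([-τ,0], ℝᵐ)` with the sup norm; `ℝᵐ` carries the max norm. -/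
abbrev Hist (τ : ℝ) (m : ℕ) : Type := C(Set.Icc (-τ) (0:ℝ), Fin m → ℝ)

/-- The constant history function `c_v ∈ 𝒞`. -/
def histConst {m : ℕ} (τ : ℝ) (v : Fin m → ℝ) : Hist τ m := ContinuousMap.const _ v

-- The history segment `y_t ∈ 𝒞`, defined by `y_t(s) = y(t+s)` for `s ∈ [-τ,0]`
-- (junk value if `y` is not continuous).
open Classical in
def seg {m : ℕ} (τ : ℝ) (y : ℝ → Fin m → ℝ) (t : ℝ) : Hist τ m :=
  if hy : Continuous y then
    ⟨fun s => y (t + s.1), hy.comp (continuous_const.add continuous_subtype_val)⟩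
  else 0

/-- Operator norm of a matrix, induced by the maximum norms. -/
def opNormMax {m n : ℕ} (W : Matrix (Fin m) (Fin n) ℝ) : ℝ :=
  ‖LinearMap.toContinuousLinearMap W.mulVecLin‖

/-- `y` is a (continuous) solution on `[0,T]` of the DDE `y'(t) = F(t, y_t)` with constant
initial data `y ≡ v` on `[-τ,0]` (one-sided derivatives at the endpoints of `[0,T]`). -/
def IsSolOn {m : ℕ} (τ T : ℝ) (F : ℝ → Hist τ m → Fin m → ℝ)
    (v : Fin m → ℝ) (y : ℝ → Fin m → ℝ) : Prop :=
  Continuous y ∧ (∀ s ∈ Set.Icc (-τ) (0:ℝ), y s = v) ∧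
    ∀ t ∈ Set.Icc (0:ℝ) T, HasDerivWithinAt y (F t (seg τ y t)) (Set.Icc (0:ℝ) T) t

/-- `F` is weakly nonlinear with constants `K`, `A`: continuous, `‖F(t,0)‖ ≤ A`, and globally
Lipschitz in the second variable with constant `K`. -/
def WeaklyNonlinear {m : ℕ} (τ : ℝ) (F : ℝ → Hist τ m → Fin m → ℝ) (K A : ℝ) : Prop :=
  Continuous (fun p : ℝ × Hist τ m => F p.1 p.2) ∧
    (∀ t : ℝ, ‖F t 0‖ ≤ A) ∧
    ∀ (t : ℝ) (u v : Hist τ m), ‖F t u - F t v‖ ≤ K * ‖u - v‖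

/-- `y` is a continuous solution of the DDE `y'(t) = F(t, y_t)` on `[t₀ - τ, ∞)` with initial
data `y(t₀ + s) = u(s)` for `s ∈ [-τ, 0]`. -/
def IsGlobalSol {m : ℕ} (τ : ℝ) (F : ℝ → Hist τ m → Fin m → ℝ)
    (t₀ : ℝ) (u : Hist τ m) (y : ℝ → Fin m → ℝ) : Prop :=
  Continuous y ∧ (∀ s : Set.Icc (-τ) (0:ℝ), y (t₀ + s.1) = u s) ∧
    ∀ t ∈ Set.Ici t₀, HasDerivWithinAt y (F t (seg τ y t)) (Set.Ici t₀) t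

/-- A special solution of the DDE `y'(t) = F(t, y_t)`: a (continuously differentiable) solution
defined on all of `ℝ` satisfying the growth condition `sup_t e^{-|t|/τ} ‖y(t)‖ < ∞`. -/
def IsSpecialSol {m : ℕ} (τ : ℝ) (F : ℝ → Hist τ m → Fin m → ℝ) (y : ℝ → Fin m → ℝ) : Prop :=
  Continuous y ∧ (∀ t : ℝ, HasDerivAt y (F t (seg τ y t)) t) ∧
    ∃ C : ℝ, ∀ t : ℝ, Real.exp (-|t| / τ) * ‖y t‖ ≤ C

open scoped BoundedContinuousFunction

lemma seg_apply {m : ℕ} (τ : ℝ) {y : ℝ → Fin m → ℝ} (hy : Continuous y) (t : ℝ)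
    (s : Set.Icc (-τ) (0:ℝ)) : seg τ y t s = y (t + s.1) := by
  simp [seg, hy]

lemma continuous_seg {m : ℕ} (τ : ℝ) {y : ℝ → Fin m → ℝ} (hy : Continuous y) :
    Continuous (seg τ y) := by
  refine ContinuousMap.continuous_of_continuous_uncurry _ ?_
  have h : Function.uncurry (fun t s => seg τ y t s) =
      fun p : ℝ × Set.Icc (-τ) (0:ℝ) => y (p.1 + p.2.1) :=
    funext fun p => seg_apply τ hy p.1 p.2
  exact h ▸ hy.comp (by fun_prop)

lemma seg_sub {m : ℕ} (τ : ℝ) {y z : ℝ → Fin m → ℝ} (hy : Continuous y) (hz : Continuous z)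
    (t : ℝ) : seg τ y t - seg τ z t = seg τ (fun r => y r - z r) t := by
  ext1 s
  rw [ContinuousMap.sub_apply, seg_apply τ hy, seg_apply τ hz,
    seg_apply τ (y := fun r => y r - z r) (hy.sub hz)]

/-- The exponential weight on `ℝ` centred at `t₀`. -/
def expWeight (τ t₀ t : ℝ) : ℝ := Real.exp (|t - t₀| / τ)

lemma expWeight_pos (τ t₀ t : ℝ) : 0 < expWeight τ t₀ t := Real.exp_pos _

lemma one_le_expWeight {τ : ℝ} (hτ : 0 < τ) (t₀ t : ℝ) : 1 ≤ expWeight τ t₀ t :=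
  Real.one_le_exp (by positivity)

lemma continuous_expWeight (τ t₀ : ℝ) : Continuous (expWeight τ t₀) := by
  unfold expWeight
  fun_prop

lemma expWeight_le_mul {τ : ℝ} (hτ : 0 < τ) (a b t : ℝ) :
    expWeight τ a t ≤ expWeight τ a b * expWeight τ b t := by
  unfold expWeight
  rw [← Real.exp_add, ← add_div]
  gcongr
  linarith [abs_sub_le t b a]

lemma norm_seg_le {m : ℕ} {τ : ℝ} (hτ : 0 < τ) {y : ℝ → Fin m → ℝ} (hy : Continuous y)
    {t₀ d : ℝ} (hd : ∀ r, ‖y r‖ ≤ d * expWeight τ t₀ r) (t : ℝ) :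
    ‖seg τ y t‖ ≤ d * Real.exp 1 * expWeight τ t₀ t := by
  have hd0 : 0 ≤ d :=
    nonneg_of_mul_nonneg_left ((norm_nonneg _).trans (hd t)) (expWeight_pos τ t₀ t)
  refine (ContinuousMap.norm_le _ (by have := expWeight_pos τ t₀ t; positivity)).2 fun s => ?_
  rw [seg_apply τ hy, mul_assoc]
  refine (hd _).trans (mul_le_mul_of_nonneg_left ?_ hd0)
  unfold expWeight
  rw [← Real.exp_add, Real.exp_le_exp, div_le_iff₀ hτ, add_mul, div_mul_cancel₀ _ hτ.ne', one_mul]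
  have h1 : |s.1| ≤ τ := abs_le.2 ⟨s.2.1, s.2.2.trans hτ.le⟩
  have h2 := abs_add_le (t - t₀) s.1
  rw [show t + s.1 - t₀ = t - t₀ + s.1 by ring]
  linarith

lemma norm_integral_le_expWeight {E : Type*} [NormedAddCommGroup E] [NormedSpace ℝ E]
    {τ : ℝ} (hτ : 0 < τ) {t₀ c : ℝ} {h : ℝ → E} (hh : ∀ s, ‖h s‖ ≤ c * expWeight τ t₀ s) (t : ℝ) :
    ‖∫ s in t₀..t, h s‖ ≤ c * τ * expWeight τ t₀ t := by
  have hc : 0 ≤ c :=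
    nonneg_of_mul_nonneg_left ((norm_nonneg _).trans (hh t)) (expWeight_pos τ t₀ t)
  have hint : ∀ a b : ℝ, IntervalIntegrable (fun s => c * expWeight τ t₀ s)
      MeasureTheory.volume a b :=
    fun a b => (continuous_const.mul (continuous_expWeight τ t₀)).intervalIntegrable a b
  rcases le_total t₀ t with ht | ht
  · refine (intervalIntegral.norm_integral_le_of_norm_le ht
      (Filter.Eventually.of_forall fun s _ => hh s) (hint _ _)).trans ?_
    have key : ∫ s in t₀..t, c * expWeight τ t₀ s =
        c * τ * Real.exp ((t - t₀) / τ) - c * τ * Real.exp ((t₀ - t₀) / τ) := by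
      refine intervalIntegral.integral_eq_sub_of_hasDerivAt
        (f := fun s => c * τ * Real.exp ((s - t₀) / τ)) (fun s hs => ?_) (hint _ _)
      rw [uIcc_of_le ht] at hs
      refine ((((hasDerivAt_id s).sub_const t₀).div_const τ).exp.const_mul (c * τ)).congr_deriv ?_
      rw [expWeight, abs_of_nonneg (sub_nonneg.2 hs.1)]
      simp only [id]
      field_simp
    rw [key, expWeight, abs_of_nonneg (sub_nonneg.2 ht)]
    have : 0 ≤ c * τ * Real.exp ((t₀ - t₀) / τ) := by positivity
    linarith
  · rw [intervalIntegral.integral_symm, norm_neg]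
    refine (intervalIntegral.norm_integral_le_of_norm_le ht
      (Filter.Eventually.of_forall fun s _ => hh s) (hint _ _)).trans ?_
    have key : ∫ s in t..t₀, c * expWeight τ t₀ s =
        -(c * τ) * Real.exp ((t₀ - t₀) / τ) - -(c * τ) * Real.exp ((t₀ - t) / τ) := by
      refine intervalIntegral.integral_eq_sub_of_hasDerivAt
        (f := fun s => -(c * τ) * Real.exp ((t₀ - s) / τ)) (fun s hs => ?_) (hint _ _)
      rw [uIcc_of_le ht] at hs
      refine ((((hasDerivAt_id s).const_sub t₀).div_const τ).exp.const_mul (-(c * τ))).congr_deriv ?_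
      rw [expWeight, abs_of_nonpos (sub_nonpos.2 hs.2), neg_sub]
      simp only [id]
      field_simp
    rw [key, expWeight, abs_of_nonpos (sub_nonpos.2 ht), neg_sub]
    have : 0 ≤ c * τ * Real.exp ((t₀ - t₀) / τ) := by positivity
    linarith

lemma WeaklyNonlinear.continuous_seg {m : ℕ} {τ K A : ℝ} {F : ℝ → Hist τ m → Fin m → ℝ}
    (hF : WeaklyNonlinear τ F K A) {y : ℝ → Fin m → ℝ} (hy : Continuous y) :
    Continuous fun s => F s (seg τ y s) :=
  hF.1.comp (continuous_id.prodMk (_root_.continuous_seg τ hy))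

lemma WeaklyNonlinear.norm_seg_le {m : ℕ} {τ K A : ℝ} {F : ℝ → Hist τ m → Fin m → ℝ}
    (hF : WeaklyNonlinear τ F K A) (hτ : 0 < τ) (hK : 0 < K) (hA : 0 ≤ A)
    {y : ℝ → Fin m → ℝ} (hy : Continuous y)
    {t₀ d : ℝ} (hd : ∀ r, ‖y r‖ ≤ d * expWeight τ t₀ r) (s : ℝ) :
    ‖F s (seg τ y s)‖ ≤ (A + K * d * Real.exp 1) * expWeight τ t₀ s := by
  have h1 := norm_le_norm_add_norm_sub' (F s (seg τ y s)) (F s 0)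
  have h2 := hF.2.2 s (seg τ y s) 0
  rw [sub_zero] at h2
  have h3 := mul_le_mul_of_nonneg_left (_root_.norm_seg_le hτ hy hd s) hK.le
  have h4 := mul_le_mul_of_nonneg_left (one_le_expWeight hτ t₀ s) hA
  linarith [hF.2.1 s]

lemma WeaklyNonlinear.norm_seg_sub_le {m : ℕ} {τ K A : ℝ} {F : ℝ → Hist τ m → Fin m → ℝ}
    (hF : WeaklyNonlinear τ F K A) (hτ : 0 < τ) (hK : 0 < K)
    {y z : ℝ → Fin m → ℝ} (hy : Continuous y) (hz : Continuous z)
    {t₀ d : ℝ} (hd : ∀ r, ‖y r - z r‖ ≤ d * expWeight τ t₀ r) (s : ℝ) :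
    ‖F s (seg τ y s) - F s (seg τ z s)‖ ≤ K * d * Real.exp 1 * expWeight τ t₀ s := by
  have h2 := hF.2.2 s (seg τ y s) (seg τ z s)
  rw [seg_sub τ hy hz] at h2
  have h3 := mul_le_mul_of_nonneg_left
    (_root_.norm_seg_le (y := fun r => y r - z r) hτ (hy.sub hz) hd s) hK.le
  linarith

/-- The function `t ↦ e^{|t - t₀|/τ} g(t)` of exponential growth defined by a bounded `g`. -/
def weighted {m : ℕ} (τ t₀ : ℝ) (g : ℝ →ᵇ (Fin m → ℝ)) (t : ℝ) : Fin m → ℝ :=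
  expWeight τ t₀ t • g t

lemma continuous_weighted {m : ℕ} (τ t₀ : ℝ) (g : ℝ →ᵇ (Fin m → ℝ)) :
    Continuous (weighted τ t₀ g) :=
  (continuous_expWeight τ t₀).smul g.continuous

lemma norm_weighted_le {m : ℕ} (τ t₀ : ℝ) (g : ℝ →ᵇ (Fin m → ℝ)) (t : ℝ) :
    ‖weighted τ t₀ g t‖ ≤ ‖g‖ * expWeight τ t₀ t := by
  rw [weighted, norm_smul, Real.norm_of_nonneg (expWeight_pos τ t₀ t).le, mul_comm]
  exact mul_le_mul_of_nonneg_right (g.norm_coe_le_norm t) (expWeight_pos τ t₀ t).le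

lemma norm_weighted_sub_le {m : ℕ} (τ t₀ : ℝ) (g h : ℝ →ᵇ (Fin m → ℝ)) (t : ℝ) :
    ‖weighted τ t₀ g t - weighted τ t₀ h t‖ ≤ dist g h * expWeight τ t₀ t := by
  have := norm_weighted_le τ t₀ (g - h) t
  rwa [← dist_eq_norm, weighted, BoundedContinuousFunction.sub_apply, smul_sub] at this

/-- A continuous function of exponential growth, divided by the exponential weight. -/
def unweighted {m : ℕ} (τ t₀ : ℝ) (y : ℝ → Fin m → ℝ) (hy : Continuous y) (d : ℝ)
    (hd : ∀ t, ‖y t‖ ≤ d * expWeight τ t₀ t) : ℝ →ᵇ (Fin m → ℝ) :=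
  BoundedContinuousFunction.ofNormedAddCommGroup (fun t => (expWeight τ t₀ t)⁻¹ • y t)
    (((continuous_expWeight τ t₀).inv₀ fun t => (expWeight_pos τ t₀ t).ne').smul hy) d
    fun t => by
      rw [norm_smul, norm_inv, Real.norm_of_nonneg (expWeight_pos τ t₀ t).le,
        inv_mul_le_iff₀ (expWeight_pos τ t₀ t), mul_comm]
      exact hd t

lemma weighted_unweighted {m : ℕ} (τ t₀ : ℝ) (y : ℝ → Fin m → ℝ) (hy : Continuous y) (d : ℝ)
    (hd : ∀ t, ‖y t‖ ≤ d * expWeight τ t₀ t) :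
    weighted τ t₀ (unweighted τ t₀ y hy d hd) = y :=
  funext fun t => smul_inv_smul₀ (expWeight_pos τ t₀ t).ne' (y t)

lemma weighted_injective {m : ℕ} (τ t₀ : ℝ) :
    Function.Injective (weighted τ t₀ : (ℝ →ᵇ (Fin m → ℝ)) → ℝ → Fin m → ℝ) := fun _ _ hgh =>
  BoundedContinuousFunction.ext fun t =>
    smul_right_injective _ (expWeight_pos τ t₀ t).ne' (congrFun hgh t)

/-- The Picard integral operator of the delay equation. -/
def picardDDE {m : ℕ} (τ : ℝ) (F : ℝ → Hist τ m → Fin m → ℝ) (t₀ : ℝ) (y₀ : Fin m → ℝ)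
    (y : ℝ → Fin m → ℝ) (t : ℝ) : Fin m → ℝ :=
  y₀ + ∫ s in t₀..t, F s (seg τ y s)

lemma WeaklyNonlinear.hasDerivAt_picardDDE {m : ℕ} {τ K A : ℝ} {F : ℝ → Hist τ m → Fin m → ℝ}
    (hF : WeaklyNonlinear τ F K A) (t₀ : ℝ) (y₀ : Fin m → ℝ)
    {y : ℝ → Fin m → ℝ} (hy : Continuous y) (t : ℝ) :
    HasDerivAt (picardDDE τ F t₀ y₀ y) (F t (seg τ y t)) t :=
  ((hF.continuous_seg hy).integral_hasStrictDerivAt t₀ t).hasDerivAt.const_add y₀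

lemma WeaklyNonlinear.norm_picardDDE_le {m : ℕ} {τ K A : ℝ} {F : ℝ → Hist τ m → Fin m → ℝ}
    (hF : WeaklyNonlinear τ F K A) (hτ : 0 < τ) (hK : 0 < K) (hA : 0 ≤ A)
    (y₀ : Fin m → ℝ) {y : ℝ → Fin m → ℝ} (hy : Continuous y)
    {t₀ d : ℝ} (hd : ∀ r, ‖y r‖ ≤ d * expWeight τ t₀ r) (t : ℝ) :
    ‖picardDDE τ F t₀ y₀ y t‖ ≤
      (‖y₀‖ + (A + K * d * Real.exp 1) * τ) * expWeight τ t₀ t := by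
  have h1 := norm_integral_le_expWeight hτ (hF.norm_seg_le hτ hK hA hy hd) t
  have h2 := mul_le_mul_of_nonneg_left (one_le_expWeight hτ t₀ t) (norm_nonneg y₀)
  refine (norm_add_le _ _).trans ?_
  linarith

lemma WeaklyNonlinear.norm_picardDDE_sub_le {m : ℕ} {τ K A : ℝ}
    {F : ℝ → Hist τ m → Fin m → ℝ} (hF : WeaklyNonlinear τ F K A) (hτ : 0 < τ) (hK : 0 < K)
    (y₀ : Fin m → ℝ) {y z : ℝ → Fin m → ℝ} (hy : Continuous y) (hz : Continuous z)
    {t₀ d : ℝ} (hd : ∀ r, ‖y r - z r‖ ≤ d * expWeight τ t₀ r) (t : ℝ) :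
    ‖picardDDE τ F t₀ y₀ y t - picardDDE τ F t₀ y₀ z t‖ ≤
      K * d * Real.exp 1 * τ * expWeight τ t₀ t := by
  rw [picardDDE, picardDDE, add_sub_add_left_eq_sub, ← intervalIntegral.integral_sub
    ((hF.continuous_seg hy).intervalIntegrable _ _) ((hF.continuous_seg hz).intervalIntegrable _ _)]
  exact norm_integral_le_expWeight hτ (hF.norm_seg_sub_le hτ hK hy hz hd) t

/-- The Picard operator, conjugated to act on bounded continuous functions. -/
def picardBounded {m : ℕ} {τ K A : ℝ} {F : ℝ → Hist τ m → Fin m → ℝ}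
    (hF : WeaklyNonlinear τ F K A) (hτ : 0 < τ) (hK : 0 < K) (hA : 0 ≤ A)
    (t₀ : ℝ) (y₀ : Fin m → ℝ) (g : ℝ →ᵇ (Fin m → ℝ)) : ℝ →ᵇ (Fin m → ℝ) :=
  unweighted τ t₀ (picardDDE τ F t₀ y₀ (weighted τ t₀ g))
    (continuous_iff_continuousAt.2 fun t =>
      (hF.hasDerivAt_picardDDE t₀ y₀ (continuous_weighted τ t₀ g) t).continuousAt)
    _ (hF.norm_picardDDE_le hτ hK hA y₀ (continuous_weighted τ t₀ g) (norm_weighted_le τ t₀ g))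

lemma weighted_picardBounded {m : ℕ} {τ K A : ℝ} {F : ℝ → Hist τ m → Fin m → ℝ}
    (hF : WeaklyNonlinear τ F K A) (hτ : 0 < τ) (hK : 0 < K) (hA : 0 ≤ A)
    (t₀ : ℝ) (y₀ : Fin m → ℝ) (g : ℝ →ᵇ (Fin m → ℝ)) :
    weighted τ t₀ (picardBounded hF hτ hK hA t₀ y₀ g) =
      picardDDE τ F t₀ y₀ (weighted τ t₀ g) :=
  weighted_unweighted _ _ _ _ _ _

lemma contracting_picardBounded {m : ℕ} {τ K A : ℝ} {F : ℝ → Hist τ m → Fin m → ℝ}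
    (hF : WeaklyNonlinear τ F K A) (hτ : 0 < τ) (hK : 0 < K) (hA : 0 ≤ A)
    (hsmall : K * τ * Real.exp 1 < 1) (t₀ : ℝ) (y₀ : Fin m → ℝ) :
    ContractingWith ⟨K * τ * Real.exp 1, by positivity⟩
      (picardBounded hF hτ hK hA t₀ y₀) := by
  refine ⟨by exact_mod_cast hsmall, LipschitzWith.of_dist_le_mul fun g h => ?_⟩
  have hq : 0 ≤ K * τ * Real.exp 1 * dist g h := by positivity
  refine (BoundedContinuousFunction.dist_le hq).2 fun t => ?_
  have h1 := hF.norm_picardDDE_sub_le hτ hK y₀ (continuous_weighted τ t₀ g)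
    (continuous_weighted τ t₀ h) (norm_weighted_sub_le τ t₀ g h) t
  rw [← weighted_picardBounded hF hτ hK hA, ← weighted_picardBounded hF hτ hK hA, weighted,
    weighted, ← smul_sub, norm_smul, Real.norm_of_nonneg (expWeight_pos τ t₀ t).le,
    ← dist_eq_norm] at h1
  refine le_of_mul_le_mul_left ?_ (expWeight_pos τ t₀ t)
  linarith

lemma IsSpecialSol.exists_norm_le {m : ℕ} {τ : ℝ} (hτ : 0 < τ) {F : ℝ → Hist τ m → Fin m → ℝ}
    {y : ℝ → Fin m → ℝ} (hy : IsSpecialSol τ F y) (t₀ : ℝ) :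
    ∃ d : ℝ, ∀ t, ‖y t‖ ≤ d * expWeight τ t₀ t := by
  obtain ⟨-, -, C, hC⟩ := hy
  refine ⟨C * expWeight τ 0 t₀, fun t => ?_⟩
  have h := hC t
  have hC0 : 0 ≤ C := le_trans (by positivity) h
  rw [neg_div, Real.exp_neg, inv_mul_le_iff₀ (Real.exp_pos _), mul_comm] at h
  have h2 := mul_le_mul_of_nonneg_left (expWeight_le_mul hτ 0 t₀ t) hC0
  rw [← mul_assoc] at h2
  refine le_trans ?_ h2
  simpa [expWeight] using h

lemma IsSpecialSol.eq_picardDDE {m : ℕ} {τ K A : ℝ} {F : ℝ → Hist τ m → Fin m → ℝ}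
    (hF : WeaklyNonlinear τ F K A) {y : ℝ → Fin m → ℝ} (hy : IsSpecialSol τ F y) (t₀ : ℝ) :
    picardDDE τ F t₀ (y t₀) y = y := by
  funext t
  rw [picardDDE, intervalIntegral.integral_eq_sub_of_hasDerivAt (fun s _ => hy.2.1 s)
    ((hF.continuous_seg hy.1).intervalIntegrable _ _), add_sub_cancel]

/-- Existence and uniqueness of special solutions for DDEs with weakly
nonlinear vector field and small memory `K·τ·e < 1`: through every `(t₀, y₀) ∈ ℝ × ℝᵐ` there
is a special solution, and it is the only globally defined solution through `(t₀, y₀)`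
satisfying the growth condition. -/
theorem existence_uniqueness_special_solutions
    {m : ℕ} (τ : ℝ) (hτ : 0 < τ) (F : ℝ → Hist τ m → Fin m → ℝ)
    (K A : ℝ) (hK : 0 < K) (hA : 0 ≤ A) (hF : WeaklyNonlinear τ F K A)
    (hsmall : K * τ * Real.exp 1 < 1) :
    ∀ (t₀ : ℝ) (y₀ : Fin m → ℝ),
      ∃ ybar : ℝ → Fin m → ℝ,
        IsSpecialSol τ F ybar ∧ ybar t₀ = y₀ ∧
        ∀ z : ℝ → Fin m → ℝ, IsSpecialSol τ F z → z t₀ = y₀ → z = ybar := by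
  intro t₀ y₀
  have hcon := contracting_picardBounded hF hτ hK hA hsmall t₀ y₀
  set g := hcon.fixedPoint
  have hg : picardDDE τ F t₀ y₀ (weighted τ t₀ g) = weighted τ t₀ g := by
    rw [← weighted_picardBounded hF hτ hK hA]
    exact congrArg (weighted τ t₀) hcon.fixedPoint_isFixedPt
  refine ⟨weighted τ t₀ g, ⟨continuous_weighted τ t₀ g, fun t => ?_, ‖g‖ * expWeight τ t₀ 0,
    fun t => ?_⟩, ?_, fun z hz hz0 => ?_⟩
  · have h := hF.hasDerivAt_picardDDE t₀ y₀ (continuous_weighted τ t₀ g) t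
    rwa [hg] at h
  · rw [neg_div, Real.exp_neg, inv_mul_le_iff₀ (Real.exp_pos _), mul_comm]
    refine (norm_weighted_le τ t₀ g t).trans ?_
    have h := mul_le_mul_of_nonneg_left (expWeight_le_mul hτ t₀ 0 t) (norm_nonneg g)
    rw [← mul_assoc] at h
    simpa [expWeight] using h
  · rw [← hg, picardDDE, intervalIntegral.integral_same, add_zero]
  · obtain ⟨d, hd⟩ := hz.exists_norm_le hτ t₀
    have hfix : Function.IsFixedPt (picardBounded hF hτ hK hA t₀ y₀)
        (unweighted τ t₀ z hz.1 d hd) := by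
      refine weighted_injective τ t₀ ?_
      rw [weighted_picardBounded, weighted_unweighted, ← hz0]
      exact hz.eq_picardDDE hF t₀
    rw [← weighted_unweighted τ t₀ z hz.1 d hd, hcon.fixedPoint_unique hfix]
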